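/- arXiv:math/9603217 — 2 statements merged into one kernel-verified Lean document; each statement's English description precedes it below -/
import Mathlib

section
/- Special case of the Legendre addition theorem: for x ∈ [−1,1] and θ ∈ ℝ, P_n(x² + (1−x²)cos θ) = P_n(x)² + 2∑_{j=1}^{n} ((n−j)!/(n+j)!) P_n^j(x)² cos jθ; in particular, P_n(x² + (1−x²)cos θ) ≥ ∑-expression with all Fourier cosine coefficients nonnegative. -/
open Finset Real
/-- The Gegenbauer (ultraspherical) polynomial `C_n^ν(x)`, via its standard explicit formula. -/
noncomputable def gegenbauer (ν : ℝ) (n : ℕ) (x : ℝ) : ℝ :=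
  ∑ m ∈ Finset.range (n / 2 + 1),
    (-1 : ℝ) ^ m * Real.Gamma (ν + (n : ℝ) - m) /
      (Real.Gamma ν * (m.factorial : ℝ) * ((n - 2 * m).factorial : ℝ)) *
        (2 * x) ^ (n - 2 * m)

/-- The Legendre polynomial `P_n = C_n^{1/2}`. -/
noncomputable def legendre (n : ℕ) (x : ℝ) : ℝ := gegenbauer (1 / 2) n x

/-- The associated Legendre function `P_n^j(x) = (-1)^j (1-x²)^{j/2} (d/dx)^j P_n(x)`. -/
noncomputable def assocLegendre (n j : ℕ) (x : ℝ) : ℝ :=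
  (-1 : ℝ) ^ j * Real.sqrt (1 - x ^ 2) ^ j * iteratedDeriv j (legendre n) x

open Polynomial in
/-- The shifted Legendre polynomial with real coefficients. -/
noncomputable def realShiftedLegendre (n : ℕ) : ℝ[X] :=
  (shiftedLegendre n).map (Int.castRingHom ℝ)

section PolynomialIdentities

open Polynomial

theorem coeff_realShiftedLegendre (n k : ℕ) :
    (realShiftedLegendre n).coeff k = (-1) ^ k * n.choose k * (n + k).choose n := by
  simp [realShiftedLegendre, coeff_shiftedLegendre]

theorem natDegree_realShiftedLegendre_le (n : ℕ) : (realShiftedLegendre n).natDegree ≤ n :=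
  natDegree_map_le.trans (natDegree_shiftedLegendre n).le

theorem coeff_realShiftedLegendre_succ (n k : ℕ) :
    ((k : ℝ) + 1) ^ 2 * (realShiftedLegendre n).coeff (k + 1) =
      -((n - k) * (n + k + 1)) * (realShiftedLegendre n).coeff k := by
  rw [coeff_realShiftedLegendre, coeff_realShiftedLegendre]
  have h₁ : (n.choose (k + 1) : ℝ) * (k + 1) = n.choose k * (n - k) := by
    rcases le_or_gt k n with h | h
    · have := Nat.choose_succ_right_eq n k
      rw [← Nat.cast_sub h]
      exact_mod_cast this
    · simp [Nat.choose_eq_zero_of_lt h, Nat.choose_eq_zero_of_lt (h.trans (Nat.lt_succ_self k))]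
  have h₂ : ((n + k + 1 : ℕ) : ℝ) * (n + k).choose n = (n + (k + 1)).choose n * (k + 1) := by
    have := Nat.add_one_mul_choose_eq (n + k) k
    rw [Nat.choose_symm_add, Nat.choose_symm_add (a := n) (b := k + 1)]
    exact_mod_cast this
  push_cast at h₂
  rw [pow_succ (-1 : ℝ) k]
  linear_combination (-(-1) ^ k * (k + 1) * ((n + (k + 1)).choose n : ℝ)) * h₁ +
    (-1) ^ k * (n.choose k : ℝ) * (n - k) * h₂

theorem coeff_X_mul_derivative (p : ℝ[X]) (k : ℕ) :
    (X * derivative p).coeff k = k * p.coeff k := by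
  cases k with
  | zero => simp
  | succ k => rw [coeff_X_mul, coeff_derivative]; push_cast; ring

theorem coeff_X_sq_mul_derivative_derivative (p : ℝ[X]) (k : ℕ) :
    (X ^ 2 * derivative (derivative p)).coeff k = k * (k - 1) * p.coeff k := by
  have h : X ^ 2 * derivative (derivative p) =
      X * derivative (X * derivative p) - X * derivative p := by
    simp only [derivative_mul, derivative_X]; ring
  rw [h, coeff_sub, coeff_X_mul_derivative, coeff_X_mul_derivative]; ring

theorem coeff_X_cube_mul_derivative_derivative_derivative (p : ℝ[X]) (k : ℕ) :
    (X ^ 3 * derivative (derivative (derivative p))).coeff k =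
      k * (k - 1) * (k - 2) * p.coeff k := by
  have h : X ^ 3 * derivative (derivative (derivative p)) =
      X * derivative (X ^ 2 * derivative (derivative p)) -
        C 2 * (X ^ 2 * derivative (derivative p)) := by
    simp only [derivative_mul, derivative_X_pow, map_ofNat, Nat.cast_ofNat]; ring
  rw [h, coeff_sub, coeff_C_mul, coeff_X_mul_derivative, coeff_X_sq_mul_derivative_derivative]
  ring

theorem realShiftedLegendre_ode (n : ℕ) :
    X * (1 - X) * derivative (derivative (realShiftedLegendre n)) +
      (1 - 2 * X) * derivative (realShiftedLegendre n) +
      C ((n : ℝ) * (n + 1)) * realShiftedLegendre n = 0 := by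
  have h : X * (1 - X) * derivative (derivative (realShiftedLegendre n)) +
      (1 - 2 * X) * derivative (realShiftedLegendre n) +
      C ((n : ℝ) * (n + 1)) * realShiftedLegendre n =
      X * derivative (derivative (realShiftedLegendre n)) -
      X ^ 2 * derivative (derivative (realShiftedLegendre n)) +
      derivative (realShiftedLegendre n) - C 2 * (X * derivative (realShiftedLegendre n)) +
      C ((n : ℝ) * (n + 1)) * realShiftedLegendre n := by
    simp only [map_ofNat]; ring
  rw [h]
  ext k
  simp only [coeff_add, coeff_sub, coeff_C_mul,
    coeff_X_sq_mul_derivative_derivative, coeff_X_mul_derivative, coeff_derivative, coeff_zero]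
  linear_combination coeff_realShiftedLegendre_succ n k

theorem iterate_derivative_realShiftedLegendre_ode (n j : ℕ) :
    X * (1 - X) * derivative (derivative (derivative^[j] (realShiftedLegendre n))) +
      C ((j : ℝ) + 1) * (1 - 2 * X) * derivative (derivative^[j] (realShiftedLegendre n)) +
      C (((n : ℝ) - j) * (n + j + 1)) * derivative^[j] (realShiftedLegendre n) = 0 := by
  induction j with
  | zero => simpa using realShiftedLegendre_ode n
  | succ j ih =>
    rw [Function.iterate_succ_apply']
    have h := congrArg derivative ih
    simp only [derivative_add, derivative_mul, derivative_sub, derivative_X, derivative_one,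
      derivative_C, derivative_ofNat, derivative_zero] at h
    simp only [map_add, map_sub, map_mul, map_natCast, map_one] at h
    simp only [Nat.cast_add, Nat.cast_one, map_add, map_sub, map_mul, map_natCast, map_one]
    linear_combination h

/-- The square of a solution of the hypergeometric-type equation
`t (1 - t) y'' + a (1 - 2 t) y' + l y = 0` solves a third order equation. -/
theorem sq_ode {y : ℝ[X]} {a l : ℝ}
    (hy : X * (1 - X) * derivative (derivative y) + C a * (1 - 2 * X) * derivative y + C l * y = 0) :
    (X * (1 - X)) ^ 2 * derivative (derivative (derivative (y ^ 2))) +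
      3 * C a * (1 - 2 * X) * (X * (1 - X)) * derivative (derivative (y ^ 2)) +
      ((2 * C a ^ 2 - C a) * (1 - 2 * X) ^ 2 - 2 * C a * (X * (1 - X)) +
        4 * C l * (X * (1 - X))) * derivative (y ^ 2) +
      (4 * C a - 2) * C l * (1 - 2 * X) * y ^ 2 = 0 := by
  have h := congrArg derivative hy
  simp only [derivative_add, derivative_mul, derivative_sub, derivative_X, derivative_one,
    derivative_C, derivative_ofNat, derivative_zero] at h
  simp only [pow_two y, derivative_add, derivative_mul]
  linear_combination (2 * y * (X * (1 - X))) * h +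
    (6 * (X * (1 - X)) * derivative y + (4 * C a - 2) * (1 - 2 * X) * y) * hy

/-- A change of variables in the third order equation of `sq_ode`. -/
theorem comp_ode {Z : ℝ[X]} {a l : ℝ}
    (hZ : X ^ 2 * (1 - 4 * X) * derivative (derivative (derivative Z)) +
      (3 * C a * X * (1 - 4 * X) - 6 * X ^ 2) * derivative (derivative Z) +
      ((2 * C a ^ 2 - C a) * (1 - 4 * X) - 8 * C a * X + 4 * C l * X) * derivative Z +
      (4 * C a - 2) * C l * Z = 0) :
    (X * (1 - X)) ^ 2 * derivative (derivative (derivative (Z.comp (X * (1 - X))))) +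
      3 * C a * (1 - 2 * X) * (X * (1 - X)) * derivative (derivative (Z.comp (X * (1 - X)))) +
      ((2 * C a ^ 2 - C a) * (1 - 2 * X) ^ 2 - 2 * C a * (X * (1 - X)) +
        4 * C l * (X * (1 - X))) * derivative (Z.comp (X * (1 - X))) +
      (4 * C a - 2) * C l * (1 - 2 * X) * Z.comp (X * (1 - X)) = 0 := by
  have h := congrArg (fun p : ℝ[X] => p.comp (X * (1 - X))) hZ
  simp only [add_comp, mul_comp, sub_comp, pow_comp, X_comp, one_comp, C_comp, ofNat_comp,
    zero_comp] at h
  simp only [derivative_comp, derivative_add, derivative_mul, derivative_sub, derivative_X,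
    derivative_one, derivative_zero, derivative_comp]
  linear_combination (1 - 2 * X) * h

/-- A polynomial solution of the third order equation of `sq_ode` is determined by its value
at `0`. -/
theorem eq_zero_of_ode {D : ℝ[X]} {a l : ℝ} (ha : 1 ≤ a)
    (hD : (X * (1 - X)) ^ 2 * derivative (derivative (derivative D)) +
      3 * C a * (1 - 2 * X) * (X * (1 - X)) * derivative (derivative D) +
      ((2 * C a ^ 2 - C a) * (1 - 2 * X) ^ 2 - 2 * C a * (X * (1 - X)) +
        4 * C l * (X * (1 - X))) * derivative D +
      (4 * C a - 2) * C l * (1 - 2 * X) * D = 0) (h0 : D.coeff 0 = 0) : D = 0 := by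
  have hD' : X ^ 2 * derivative (derivative (derivative D)) +
      C (3 * a) * (X * derivative (derivative D)) + C (2 * a ^ 2 - a) * derivative D +
      (C (-2) * (X ^ 3 * derivative (derivative (derivative D))) +
        C (-9 * a) * (X ^ 2 * derivative (derivative D)) +
        C (-4 * (2 * a ^ 2 - a) - 2 * a + 4 * l) * (X * derivative D) +
        C ((4 * a - 2) * l) * D) +
      X * (X ^ 3 * derivative (derivative (derivative D)) +
        C (6 * a) * (X ^ 2 * derivative (derivative D)) +
        C (4 * (2 * a ^ 2 - a) + 2 * a - 4 * l) * (X * derivative D) +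
        C (-2 * (4 * a - 2) * l) * D) = 0 := by
    simp only [map_add, map_sub, map_mul, map_neg, map_pow, map_ofNat]
    linear_combination hD
  ext k
  rw [coeff_zero]
  induction k using Nat.strong_induction_on with
  | _ k ih =>
    cases k with
    | zero => exact h0
    | succ k =>
      have hk := congrArg (fun p : ℝ[X] => p.coeff k) hD'
      have hX : ∀ p : ℝ[X], (∀ i < k, p.coeff i = 0) → (X * p).coeff k = 0 := by
        intro p hp
        cases k with
        | zero => simp
        | succ k => rw [coeff_X_mul]; exact hp k (Nat.lt_succ_self k)
      simp only [coeff_add _ _ k] at hk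
      rw [hX] at hk
      · simp only [coeff_C_mul,
          coeff_X_sq_mul_derivative_derivative, coeff_X_mul_derivative, coeff_derivative,
          coeff_X_cube_mul_derivative_derivative_derivative, coeff_zero,
          ih k (Nat.lt_succ_self k)] at hk
        have hk' : ((k : ℝ) + 1) * (k + a) * (k + 2 * a - 1) * D.coeff (k + 1) = 0 := by
          linear_combination hk
        have hpos : 0 < ((k : ℝ) + 1) * (k + a) * (k + 2 * a - 1) := by
          have : (0 : ℝ) ≤ k := k.cast_nonneg
          have : 0 < k + 2 * a - 1 := by linarith
          positivity
        exact (mul_eq_zero.mp hk').resolve_left hpos.ne'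
      · intro i hi
        simp only [coeff_add, coeff_C_mul, coeff_X_sq_mul_derivative_derivative,
          coeff_X_mul_derivative, coeff_X_cube_mul_derivative_derivative_derivative,
          ih i (hi.trans (Nat.lt_succ_self k))]
        ring

/-- The coefficients of the square of a derivative of the shifted Legendre polynomial as a
polynomial in `t (1 - t)`, up to normalization. -/
noncomputable def legendreSqPoly (n j : ℕ) : ℝ[X] :=
  ∑ m ∈ Finset.range (n + 1),
    C ((-1) ^ j * (realShiftedLegendre n).coeff (m + j) *
      ((2 * (m + j)).choose (m + j + j) : ℝ)) * X ^ m

theorem coeff_legendreSqPoly (n j m : ℕ) :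
    (legendreSqPoly n j).coeff m = (-1) ^ j * (realShiftedLegendre n).coeff (m + j) *
      ((2 * (m + j)).choose (m + j + j) : ℝ) := by
  rw [legendreSqPoly, finsetSum_coeff]
  simp_rw [coeff_C_mul_X_pow]
  rw [Finset.sum_ite_eq]
  split_ifs with h
  · rfl
  · rw [Finset.mem_range, not_lt] at h
    rw [coeff_eq_zero_of_natDegree_lt
      ((natDegree_realShiftedLegendre_le n).trans_lt (by omega : n < m + j))]
    ring

theorem choose_two_mul_add_succ (m j : ℕ) :
    ((m : ℝ) + 1) * (m + 1 + 2 * j) * (2 * (m + 1 + j)).choose (m + 1 + j + j) =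
      (2 * (m + j) + 2) * (2 * (m + j) + 1) * (2 * (m + j)).choose (m + j + j) := by
  have e₁ : 2 * (m + 1 + j) = (m + 1 + j + j) + (m + 1) := by ring
  have e₂ : 2 * (m + j) = (m + j + j) + m := by ring
  have e₃ : m + 1 + j + j + (m + 1) = m + j + j + m + 1 + 1 := by ring
  rw [e₁, e₂, Nat.cast_add_choose, Nat.cast_add_choose, e₃,
    show m + 1 + j + j = m + j + j + 1 by ring]
  simp only [Nat.factorial_succ]
  push_cast
  have h₁ := Nat.cast_ne_zero (R := ℝ).mpr (Nat.factorial_ne_zero (m + j + j))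
  have h₂ := Nat.cast_ne_zero (R := ℝ).mpr (Nat.factorial_ne_zero m)
  have h₃ : (m : ℝ) + j + j + 1 ≠ 0 := by positivity
  field_simp
  ring

theorem legendreSqPoly_ode (n j : ℕ) :
    X ^ 2 * (1 - 4 * X) * derivative (derivative (derivative (legendreSqPoly n j))) +
      (3 * C ((j : ℝ) + 1) * X * (1 - 4 * X) - 6 * X ^ 2) *
        derivative (derivative (legendreSqPoly n j)) +
      ((2 * C ((j : ℝ) + 1) ^ 2 - C ((j : ℝ) + 1)) * (1 - 4 * X) - 8 * C ((j : ℝ) + 1) * X +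
        4 * C (((n : ℝ) - j) * (n + j + 1)) * X) * derivative (legendreSqPoly n j) +
      (4 * C ((j : ℝ) + 1) - 2) * C (((n : ℝ) - j) * (n + j + 1)) * legendreSqPoly n j = 0 := by
  set a : ℝ := (j : ℝ) + 1 with ha
  set l : ℝ := ((n : ℝ) - j) * (n + j + 1) with hl
  set Z := legendreSqPoly n j with hZ
  have h : X ^ 2 * derivative (derivative (derivative Z)) +
      C (-4) * (X ^ 3 * derivative (derivative (derivative Z))) +
      C (3 * a) * (X * derivative (derivative Z)) +
      C (-12 * a - 6) * (X ^ 2 * derivative (derivative Z)) +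
      C (2 * a ^ 2 - a) * derivative Z +
      C (-4 * (2 * a ^ 2 - a) - 8 * a + 4 * l) * (X * derivative Z) +
      C ((4 * a - 2) * l) * Z = 0 := by
    ext k
    simp only [coeff_add, coeff_C_mul,
      coeff_X_sq_mul_derivative_derivative, coeff_X_mul_derivative, coeff_derivative,
      coeff_X_cube_mul_derivative_derivative_derivative, coeff_zero, hZ, coeff_legendreSqPoly]
    have h₁ := coeff_realShiftedLegendre_succ n (k + j)
    have h₂ := choose_two_mul_add_succ k j
    rw [show k + j + 1 = k + 1 + j by ring] at h₁
    push_cast at h₁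
    have h₃ : (k : ℝ) + j + 1 ≠ 0 := by positivity
    apply mul_left_cancel₀ h₃
    simp only [ha, hl]
    generalize (realShiftedLegendre n).coeff (k + 1 + j) = c₁ at *
    generalize (realShiftedLegendre n).coeff (k + j) = c₀ at *
    generalize ((2 * (k + 1 + j)).choose (k + 1 + j + j) : ℝ) = b₁ at *
    generalize ((2 * (k + j)).choose (k + j + j) : ℝ) = b₀ at *
    linear_combination (-1) ^ j * ((k : ℝ) + j + 1) ^ 2 * c₁ * h₂ +
      (-1) ^ j * (2 * ((k : ℝ) + j) + 2) * (2 * (k + j) + 1) * b₀ * h₁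
  simp only [map_add, map_sub, map_mul, map_neg, map_pow, map_ofNat] at h
  linear_combination h

theorem legendreSqPoly_comp {n j : ℕ} (hj : j ≤ n) :
    (legendreSqPoly n j).comp (X * (1 - X)) =
      C (((n - j).factorial : ℝ) / (n + j).factorial) *
        (derivative^[j] (realShiftedLegendre n)) ^ 2 := by
  rw [← sub_eq_zero]
  refine eq_zero_of_ode (a := (j : ℝ) + 1) (l := ((n : ℝ) - j) * (n + j + 1))
    (by simp) ?_ ?_
  · have h₁ := comp_ode (legendreSqPoly_ode n j)
    have h₂ := sq_ode (iterate_derivative_realShiftedLegendre_ode n j)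
    simp only [derivative_sub, derivative_C_mul]
    linear_combination h₁ - C (((n - j).factorial : ℝ) / (n + j).factorial) * h₂
  · rw [coeff_sub, coeff_C_mul, coeff_zero_eq_eval_zero, eval_comp, pow_two, mul_coeff_zero,
      coeff_iterate_derivative]
    simp only [eval_mul, eval_X, zero_mul, ← coeff_zero_eq_eval_zero, coeff_legendreSqPoly,
      zero_add, coeff_realShiftedLegendre, Nat.descFactorial_self, nsmul_eq_mul]
    rw [show 2 * j = j + j by ring, Nat.choose_self, Nat.cast_choose ℝ hj, Nat.cast_add_choose]
    have h₁ := Nat.cast_ne_zero (R := ℝ).mpr (Nat.factorial_ne_zero (n - j))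
    have h₂ := Nat.cast_ne_zero (R := ℝ).mpr (Nat.factorial_ne_zero (n + j))
    have h₃ := Nat.cast_ne_zero (R := ℝ).mpr (Nat.factorial_ne_zero n)
    have h₄ := Nat.cast_ne_zero (R := ℝ).mpr (Nat.factorial_ne_zero j)
    have h₅ : ((-1 : ℝ) ^ j) ^ 2 = 1 := by rw [← pow_mul, mul_comm, pow_mul]; simp
    field_simp
    push_cast
    ring

theorem sum_coeff_mul_choose_mul_pow {n j : ℕ} (hj : j ≤ n) (s : ℝ) :
    ∑ k ∈ Finset.range (n + 1), (-1) ^ j * (realShiftedLegendre n).coeff k *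
        ((2 * k).choose (k + j) : ℝ) * (s * (1 - s)) ^ k =
      ((n - j).factorial : ℝ) / (n + j).factorial * (s * (1 - s)) ^ j *
        (derivative^[j] (realShiftedLegendre n)).eval s ^ 2 := by
  set v := s * (1 - s) with hv
  set f : ℕ → ℝ := fun k => (-1) ^ j * (realShiftedLegendre n).coeff k *
        ((2 * k).choose (k + j) : ℝ) * v ^ k with hf
  have h := congrArg (eval s) (legendreSqPoly_comp hj)
  simp only [eval_comp, eval_mul, eval_X, eval_sub, eval_one, eval_C, eval_pow, ← hv] at h
  have h₁ : ∑ k ∈ Finset.range (n + 1 + j), f k = ∑ k ∈ Finset.range (n + 1), f k := by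
    rw [Finset.sum_range_add, add_eq_left]
    refine Finset.sum_eq_zero fun k _ => ?_
    simp only [hf]
    rw [coeff_eq_zero_of_natDegree_lt
      ((natDegree_realShiftedLegendre_le n).trans_lt (by omega : n < n + 1 + k))]
    ring
  have h₂ : ∑ k ∈ Finset.range (j + (n + 1)), f k = v ^ j * (legendreSqPoly n j).eval v := by
    rw [Finset.sum_range_add, Finset.sum_eq_zero, zero_add, legendreSqPoly, eval_finsetSum,
      Finset.mul_sum]
    · refine Finset.sum_congr rfl fun m _ => ?_
      simp only [hf, eval_mul, eval_C, eval_pow, eval_X, add_comm j m, pow_add]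
      ring
    · intro k hk
      rw [Finset.mem_range] at hk
      simp only [hf]
      rw [Nat.choose_eq_zero_of_lt (by omega)]
      simp
  rw [← h₁, add_comm (n + 1) j, h₂, h]
  ring

end PolynomialIdentities

section LegendreFunction

open Polynomial

theorem iterate_derivative_comp_of_derivative_eq_C {l : ℝ[X]} {b : ℝ} (hl : derivative l = C b)
    (p : ℝ[X]) (k : ℕ) :
    derivative^[k] (p.comp l) = C (b ^ k) * (derivative^[k] p).comp l := by
  induction k with
  | zero => simp
  | succ k ih =>
    rw [Function.iterate_succ_apply', ih, derivative_C_mul, derivative_comp, hl,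
      Function.iterate_succ_apply', pow_succ, C_mul]
    ring

theorem derivative_half_sub_half_X :
    derivative (C (1 / 2 : ℝ) - C (1 / 2) * X) = C (-1 / 2) := by
  rw [derivative_sub, derivative_C, derivative_C_mul, derivative_X, ← C_1, ← C_mul, ← C_0, ← C_sub]
  norm_num

theorem factorial_mul_realShiftedLegendre (n : ℕ) :
    C (n.factorial : ℝ) * realShiftedLegendre n = derivative^[n] (X ^ n * (1 - X) ^ n) := by
  have h := congrArg (map (Int.castRingHom ℝ)) (factorial_mul_shiftedLegendre_eq n)
  rw [← iterate_derivative_map] at h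
  simpa [realShiftedLegendre] using h

theorem iterate_derivative_one_sub_X_sq_pow_eval (n : ℕ) (x : ℝ) :
    (derivative^[n] ((1 - X ^ 2 : ℝ[X]) ^ n)).eval x =
      ∑ m ∈ Finset.range (n / 2 + 1), (-1) ^ (n - m) * (n.choose m : ℝ) *
        ((2 * (n - m)).factorial / (n - 2 * m).factorial) * x ^ (n - 2 * m) := by
  have h : (1 - X ^ 2 : ℝ[X]) ^ n = ∑ m ∈ Finset.range (n + 1),
      C ((-1) ^ (n - m) * (n.choose m : ℝ)) * X ^ (2 * (n - m)) := by
    rw [sub_eq_add_neg, add_pow]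
    refine Finset.sum_congr rfl fun m _ => ?_
    rw [neg_pow, ← pow_mul]
    simp
    ring
  rw [h, iterate_derivative_sum, eval_finsetSum]
  symm
  apply Finset.sum_subset_zero_on_sdiff
  · intro m hm
    simp only [Finset.mem_range] at *
    omega
  · intro m hm
    simp only [Finset.mem_sdiff, Finset.mem_range] at hm
    rw [iterate_derivative_C_mul, iterate_derivative_X_pow_eq_C_mul,
      Nat.descFactorial_of_lt (by omega)]
    simp
  · intro m hm
    rw [Finset.mem_range] at hm
    have hle : n ≤ 2 * (n - m) := by omega
    have hd := Nat.factorial_mul_descFactorial hle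
    rw [show 2 * (n - m) - n = n - 2 * m by omega] at hd
    rw [iterate_derivative_C_mul, iterate_derivative_X_pow_eq_C_mul,
      show 2 * (n - m) - n = n - 2 * m by omega, ← hd]
    have h₁ := Nat.cast_ne_zero (R := ℝ).mpr (Nat.factorial_ne_zero (n - 2 * m))
    simp only [eval_mul, eval_C, eval_pow, eval_X]
    push_cast
    field_simp

theorem Gamma_nat_add_half_mul (k : ℕ) :
    Real.Gamma (k + 1 / 2) * (4 ^ k * k.factorial) =
      (2 * k).factorial * Real.Gamma (1 / 2) := by
  induction k with
  | zero => simp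
  | succ k ih =>
    rw [show ((k + 1 : ℕ) : ℝ) + 1 / 2 = (k + 1 / 2) + 1 by push_cast; ring,
      Real.Gamma_add_one (by positivity), show 2 * (k + 1) = 2 * k + 1 + 1 by ring]
    simp only [Nat.factorial_succ]
    push_cast
    linear_combination (4 * ((k : ℝ) + 1 / 2) * (k + 1)) * ih

theorem legendre_eq_eval (n : ℕ) (x : ℝ) :
    legendre n x = ((realShiftedLegendre n).comp (C (1 / 2) - C (1 / 2) * X)).eval x := by
  have hr : (X ^ n * (1 - X) ^ n : ℝ[X]).comp (C (1 / 2) - C (1 / 2) * X) =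
      C ((1 / 4) ^ n) * (1 - X ^ 2) ^ n := by
    have h₁ : (1 : ℝ[X]) = C (1 / 2) + C (1 / 2) := by rw [← C_add]; norm_num
    have h₄ : (C (1 / 4) : ℝ[X]) = C (1 / 2) * C (1 / 2) := by rw [← C_mul]; norm_num
    simp only [mul_comp, pow_comp, X_comp, sub_comp, one_comp, C_pow]
    rw [← mul_pow, ← mul_pow, h₄]
    congr 1
    linear_combination (C (1 / 2) - C (1 / 2) * X) * h₁
  have h := iterate_derivative_comp_of_derivative_eq_C derivative_half_sub_half_X
    (X ^ n * (1 - X) ^ n : ℝ[X]) n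
  rw [hr, iterate_derivative_C_mul, ← factorial_mul_realShiftedLegendre, mul_comp, C_comp] at h
  replace h := congrArg (eval x) h
  simp only [eval_mul, eval_C] at h
  rw [iterate_derivative_one_sub_X_sq_pow_eval] at h
  have hn := Nat.cast_ne_zero (R := ℝ).mpr (Nat.factorial_ne_zero n)
  have h2 : (-1 / 2 : ℝ) ^ n ≠ 0 := pow_ne_zero _ (by norm_num)
  apply mul_left_cancel₀ hn
  apply mul_left_cancel₀ h2
  rw [← h, legendre, gegenbauer, Finset.mul_sum, Finset.mul_sum, Finset.mul_sum]
  refine Finset.sum_congr rfl fun m hm => ?_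
  rw [Finset.mem_range] at hm
  have hmn : 2 * m ≤ n := by omega
  obtain ⟨d, rfl⟩ := Nat.exists_eq_add_of_le hmn
  have hG := Gamma_nat_add_half_mul (m + d)
  rw [show (1 / 2 : ℝ) + ((2 * m + d : ℕ) : ℝ) - m = ((m + d : ℕ) : ℝ) + 1 / 2 by push_cast; ring,
    show 2 * m + d - 2 * m = d by omega, show 2 * m + d - m = m + d by omega,
    Nat.cast_choose ℝ (show m ≤ 2 * m + d by omega), show 2 * m + d - m = m + d by omega]
  have hΓ : Real.Gamma (1 / 2) ≠ 0 := (Real.Gamma_pos_of_pos (by norm_num)).ne'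
  have hG' : Real.Gamma (((m + d : ℕ) : ℝ) + 1 / 2) =
      (2 * (m + d)).factorial * Real.Gamma (1 / 2) / (4 ^ (m + d) * (m + d).factorial) := by
    rw [eq_div_iff (by positivity), hG]
  rw [hG', show (-1 / 2 : ℝ) = (-1) * (1 / 2) by norm_num, mul_pow (-1 : ℝ), mul_pow (2 : ℝ),
    show (4 : ℝ) = 2 * 2 by norm_num, one_div_pow, one_div_pow, mul_pow, mul_pow]
  field_simp
  simp only [pow_add, pow_mul, neg_one_sq, one_pow]
  have h4 : (4 : ℝ) ^ m = (2 ^ m) ^ 2 := by rw [← pow_mul, mul_comm, pow_mul]; norm_num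
  ring_nf
  simp [pow_mul, h4]

theorem iteratedDeriv_legendre (n j : ℕ) (x : ℝ) :
    iteratedDeriv j (legendre n) x =
      (-1 / 2) ^ j * (derivative^[j] (realShiftedLegendre n)).eval ((1 - x) / 2) := by
  have h : ∀ (p : ℝ[X]) (k : ℕ), iteratedDeriv k (fun t => p.eval t) =
      fun t => (derivative^[k] p).eval t := by
    intro p k
    induction k with
    | zero => simp
    | succ k ih =>
      rw [iteratedDeriv_succ, ih, Function.iterate_succ_apply']
      ext t
      exact Polynomial.deriv _
  rw [funext (legendre_eq_eval n), h,
    iterate_derivative_comp_of_derivative_eq_C derivative_half_sub_half_X]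
  beta_reduce
  rw [eval_mul, eval_C, eval_comp]
  congr 2
  simp
  ring

theorem legendre_eq_sum (n : ℕ) (x : ℝ) :
    legendre n x = ∑ k ∈ Finset.range (n + 1),
      (realShiftedLegendre n).coeff k * ((1 - x) / 2) ^ k := by
  rw [legendre_eq_eval, eval_comp,
    eval_eq_sum_range' (Nat.lt_succ_of_le (natDegree_realShiftedLegendre_le n))]
  refine Finset.sum_congr rfl fun k _ => ?_
  congr 2
  simp
  ring

end LegendreFunction

theorem two_sub_two_cos_pow (k : ℕ) (θ : ℝ) :
    (2 - 2 * Real.cos θ) ^ k =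
      ∑ i ∈ Finset.range (2 * k + 1),
        (-1) ^ (i + k) * ((2 * k).choose i : ℝ) * Real.cos (((i : ℝ) - k) * θ) := by
  have hz : Complex.exp (θ * Complex.I) * Complex.exp (-(θ * Complex.I)) = 1 := by
    rw [← Complex.exp_add]; simp
  have h : ((2 : ℂ) - 2 * Complex.cos θ) ^ k =
      ∑ i ∈ Finset.range (2 * k + 1),
        (-1) ^ (i + k) * ((2 * k).choose i : ℂ) * Complex.exp ((((i : ℝ) - k) * θ : ℝ) * Complex.I) := by
    have hc : (2 : ℂ) - 2 * Complex.cos θ =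
        -(Complex.exp (-(θ * Complex.I)) * (-Complex.exp (θ * Complex.I) + 1) ^ 2) := by
      rw [Complex.cos, neg_mul]
      linear_combination (Complex.exp (θ * Complex.I) - 2) * hz
    rw [hc, neg_pow, mul_pow, ← pow_mul, add_pow, Finset.mul_sum, Finset.mul_sum]
    refine Finset.sum_congr rfl fun i _ => ?_
    have he : Complex.exp ((((i : ℝ) - k) * θ : ℝ) * Complex.I) =
        Complex.exp (θ * Complex.I) ^ i * Complex.exp (-(θ * Complex.I)) ^ k := by
      rw [← Complex.exp_nat_mul, ← Complex.exp_nat_mul, ← Complex.exp_add]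
      congr 1
      push_cast
      ring
    rw [he, neg_pow (Complex.exp (θ * Complex.I)) i, pow_add]
    ring
  have h' := congrArg Complex.re h
  rw [Complex.re_sum, ← Complex.ofReal_cos,
    show ((2 : ℂ) - 2 * (Real.cos θ : ℂ)) ^ k = (((2 - 2 * Real.cos θ) ^ k : ℝ) : ℂ) by push_cast; rfl,
    Complex.ofReal_re] at h'
  rw [h']
  refine Finset.sum_congr rfl fun i _ => ?_
  rw [show ((-1 : ℂ) ^ (i + k) * ((2 * k).choose i : ℂ)) =
    (((-1) ^ (i + k) * ((2 * k).choose i : ℝ) : ℝ) : ℂ) by push_cast; rfl, Complex.re_ofReal_mul,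
    Complex.exp_ofReal_mul_I_re]

/-- Fourier cosine expansion of a power of `sin² (θ / 2)`. -/
theorem two_sub_two_cos_pow_eq_fourier {k n : ℕ} (hk : k ≤ n) (θ : ℝ) :
    (2 - 2 * Real.cos θ) ^ k = ((2 * k).choose k : ℝ) +
      2 * ∑ j ∈ Finset.Icc 1 n, (-1) ^ j * ((2 * k).choose (k + j) : ℝ) * Real.cos (j * θ) := by
  set g : ℕ → ℝ := fun j => (-1) ^ j * ((2 * k).choose (k + j) : ℝ) * Real.cos (j * θ) with hg
  have hn : ∑ j ∈ Finset.Icc 1 n, g j = ∑ j ∈ Finset.range k, g (j + 1) := by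
    rw [Finset.range_eq_Ico, Finset.sum_Ico_add' g 0 k 1]
    symm
    refine Finset.sum_subset ?_ ?_
    · intro j hj
      simp only [Finset.mem_Ico, Finset.mem_Icc] at *
      omega
    · intro j hj hj'
      simp only [Finset.mem_Ico, Finset.mem_Icc] at *
      simp only [hg]
      rw [Nat.choose_eq_zero_of_lt (by omega)]
      simp
  rw [hn, two_sub_two_cos_pow, show 2 * k + 1 = k + 1 + k by ring, Finset.sum_range_add,
    Finset.sum_range_succ, ← Finset.sum_range_reflect]
  have h₁ : ∀ j ∈ Finset.range k, (-1 : ℝ) ^ (k - 1 - j + k) * ((2 * k).choose (k - 1 - j) : ℝ) *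
      Real.cos ((((k - 1 - j : ℕ) : ℝ) - k) * θ) = g (j + 1) := by
    intro j hj
    rw [Finset.mem_range] at hj
    have hc : (2 * k).choose (k - 1 - j) = (2 * k).choose (k + (j + 1)) :=
      Nat.choose_symm_of_eq_add (by omega)
    have hs : (-1 : ℝ) ^ (k - 1 - j + k) = (-1) ^ (j + 1) := by
      apply neg_one_pow_congr
      rw [Nat.even_iff, Nat.even_iff]
      omega
    have hcos : ((k - 1 - j : ℕ) : ℝ) - k = -((j + 1 : ℕ) : ℝ) := by
      rw [Nat.sub_sub, Nat.cast_sub (by omega)]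
      push_cast
      ring
    rw [hc, hs, hcos, neg_mul, Real.cos_neg]
  have h₂ : ∀ j ∈ Finset.range k, (-1 : ℝ) ^ (k + 1 + j + k) * ((2 * k).choose (k + 1 + j) : ℝ) *
      Real.cos ((((k + 1 + j : ℕ) : ℝ) - k) * θ) = g (j + 1) := by
    intro j _
    have hs : (-1 : ℝ) ^ (k + 1 + j + k) = (-1) ^ (j + 1) := by
      apply neg_one_pow_congr
      rw [Nat.even_iff, Nat.even_iff]
      omega
    have hcos : ((k + 1 + j : ℕ) : ℝ) - k = ((j + 1 : ℕ) : ℝ) := by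
      push_cast
      ring
    rw [hs, hcos, show k + 1 + j = k + (j + 1) by ring]
  rw [Finset.sum_congr rfl h₁, Finset.sum_congr rfl h₂]
  simp only [sub_self, zero_mul, Real.cos_zero, mul_one, ← two_mul, pow_mul, neg_one_sq, one_pow]
  ring

theorem sq_assocLegendre (n j : ℕ) {x : ℝ} (hx : x ∈ Set.Icc (-1 : ℝ) 1) :
    assocLegendre n j x ^ 2 = ((1 - x) / 2 * (1 - (1 - x) / 2)) ^ j *
      (Polynomial.derivative^[j] (realShiftedLegendre n)).eval ((1 - x) / 2) ^ 2 := by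
  have hw : 0 ≤ 1 - x ^ 2 := by nlinarith [hx.1, hx.2]
  rw [assocLegendre, iteratedDeriv_legendre]
  generalize (Polynomial.derivative^[j] (realShiftedLegendre n)).eval ((1 - x) / 2) = y
  have hb : ((-1) * √(1 - x ^ 2) * (-1 / 2)) ^ 2 = (1 - x) / 2 * (1 - (1 - x) / 2) := by
    linear_combination (1 / 4) * Real.sq_sqrt hw
  rw [← hb, ← pow_mul, mul_comm 2 j, pow_mul, ← mul_pow, mul_pow _ (_ / 2), mul_pow (-1),
    ← mul_pow _ y, mul_assoc _ _ y]

/-- Special case of the Legendre addition theorem, with nonnegative Fourier cosine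
coefficients. -/
theorem legendre_addition_special (n : ℕ) (x : ℝ) (hx : x ∈ Set.Icc (-1 : ℝ) 1) (θ : ℝ) :
    legendre n (x ^ 2 + (1 - x ^ 2) * Real.cos θ) =
        legendre n x ^ 2 +
          2 * ∑ j ∈ Finset.Icc 1 n,
            ((n - j).factorial : ℝ) / ((n + j).factorial : ℝ) *
              assocLegendre n j x ^ 2 * Real.cos (j * θ) ∧
      ∀ j : ℕ, 0 ≤ ((n - j).factorial : ℝ) / ((n + j).factorial : ℝ) *
        assocLegendre n j x ^ 2 := by
  refine ⟨?_, fun j => by positivity⟩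
  set s := (1 - x) / 2 with hs
  set c : ℕ → ℝ := (realShiftedLegendre n).coeff with hc
  have hterm : ∀ j ≤ n, ((n - j).factorial : ℝ) / ((n + j).factorial : ℝ) *
      assocLegendre n j x ^ 2 = ∑ k ∈ Finset.range (n + 1), (-1) ^ j * c k *
        ((2 * k).choose (k + j) : ℝ) * (s * (1 - s)) ^ k := by
    intro j hj
    rw [sum_coeff_mul_choose_mul_pow hj, sq_assocLegendre n j hx]
    ring
  have hzero : legendre n x ^ 2 = ∑ k ∈ Finset.range (n + 1), c k *
        ((2 * k).choose k : ℝ) * (s * (1 - s)) ^ k := by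
    have h := hterm 0 n.zero_le
    have hf := Nat.cast_ne_zero (R := ℝ).mpr (Nat.factorial_ne_zero n)
    simpa [assocLegendre, hf] using h
  have hsum : ∀ j ∈ Finset.Icc 1 n, ((n - j).factorial : ℝ) / ((n + j).factorial : ℝ) *
      assocLegendre n j x ^ 2 * Real.cos (j * θ) = ∑ k ∈ Finset.range (n + 1), (-1) ^ j * c k *
        ((2 * k).choose (k + j) : ℝ) * (s * (1 - s)) ^ k * Real.cos (j * θ) := by
    intro j hj
    rw [hterm j (Finset.mem_Icc.mp hj).2, Finset.sum_mul]
  rw [Finset.sum_congr rfl hsum, Finset.sum_comm, hzero, Finset.mul_sum, ← Finset.sum_add_distrib,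
    legendre_eq_sum]
  refine Finset.sum_congr rfl fun k hk => ?_
  have hv : (1 - (x ^ 2 + (1 - x ^ 2) * Real.cos θ)) / 2 =
      s * (1 - s) * (2 - 2 * Real.cos θ) := by
    rw [hs]
    ring
  rw [hv, mul_pow,
    two_sub_two_cos_pow_eq_fourier (Nat.lt_succ_iff.mp (Finset.mem_range.mp hk)), mul_add,
    mul_add, Finset.mul_sum, Finset.mul_sum, Finset.mul_sum, Finset.mul_sum]
  congr 1
  · ring
  · refine Finset.sum_congr rfl fun j _ => ?_
    ring
end

section
/- Askey–Gasper type identity: for every k, n ∈ ℕ and y ∈ [−1,1], ∑_{j=0}^{n} P_j^{(2k,0)}(2y²−1) = ∑_{j=0}^{n} (2j+2k+1) · (4^{j+2k} ((j+k)!)² (n−j)! j! ((1/2)_k)²) / ((2k+n+j+1)! (j+2k)!) · (1−y²)^j · C_j^{1/2+k}(0)² · (C_{n−j}^{j+k+1}(y))². In particular, ∑_{j=0}^{n} P_j^{(2k,0)}(x) ≥ 0 for all x ∈ [−1,1]. -/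
open Finset Real
/-- Generalized binomial coefficient `a` choose `k`. -/
noncomputable def rbinom (a : ℝ) (k : ℕ) : ℝ :=
  (∏ i ∈ Finset.range k, (a - i)) / (k.factorial : ℝ)

/-- The Jacobi polynomial `P_j^{(α,β)}(x)` via the standard explicit formula. -/
noncomputable def jacobi (α β : ℝ) (j : ℕ) (x : ℝ) : ℝ :=
  ∑ m ∈ Finset.range (j + 1),
    rbinom ((j : ℝ) + α) (j - m) * rbinom ((j : ℝ) + β) m *
      ((x - 1) / 2) ^ m * ((x + 1) / 2) ^ (j - m)


open Polynomial in
/-- Polynomial form of the Gegenbauer polynomial with parameter `L + 1`. -/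
noncomputable def gegenbauerPoly (L N : ℕ) : ℝ[X] :=
  ∑ m ∈ Finset.range (N / 2 + 1),
    C ((-1 : ℝ) ^ m * ((L + N - m).factorial : ℝ) /
      ((L.factorial : ℝ) * (m.factorial : ℝ) * ((N - 2 * m).factorial : ℝ)) * 2 ^ (N - 2 * m)) *
        X ^ (N - 2 * m)

open Polynomial in
theorem gegenbauerPoly_ode (L N : ℕ) :
    (1 - X ^ 2) * derivative (derivative (gegenbauerPoly L N)) =
      C (2 * L + 3 : ℝ) * X * derivative (gegenbauerPoly L N) -
        C (N * (N + 2 * L + 2) : ℝ) * gegenbauerPoly L N := by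
  set c : ℕ → ℝ := fun m => (-1 : ℝ) ^ m * ((L + N - m).factorial : ℝ) /
      ((L.factorial : ℝ) * (m.factorial : ℝ) * ((N - 2 * m).factorial : ℝ)) * 2 ^ (N - 2 * m)
    with hc
  set T : ℕ → ℝ[X] := fun m => if 2 * m ≤ N then
    C (4 * m * (N - m + L + 1) * c m) * X ^ (N - 2 * m) else 0 with hT
  have hstep : ∀ m ∈ Finset.range (N / 2 + 1),
      (1 - X ^ 2) * derivative (derivative (C (c m) * X ^ (N - 2 * m))) -
        C (2 * L + 3 : ℝ) * X * derivative (C (c m) * X ^ (N - 2 * m)) +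
        C (N * (N + 2 * L + 2) : ℝ) * (C (c m) * X ^ (N - 2 * m)) = T m - T (m + 1) := by
    intro m hm
    have hm2 : 2 * m ≤ N := by have := Finset.mem_range.1 hm; omega
    obtain ⟨q, rfl⟩ := Nat.exists_eq_add_of_le hm2
    simp only [hT, hm2, if_true]
    have hq : 2 * m + q - 2 * m = q := by omega
    rw [hq]
    rcases q with _ | _ | q
    · rw [if_neg (by omega)]
      simp only [pow_zero, mul_one, derivative_C, map_mul, map_add, map_sub,
        map_natCast, map_ofNat, Nat.cast_add, Nat.cast_mul, Nat.cast_ofNat, Nat.cast_zero, map_one,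
        map_zero]
      ring
    · rw [if_neg (by omega)]
      simp only [zero_add, pow_one, derivative_C_mul, derivative_X, derivative_C, mul_one,
        map_mul, map_add, map_sub,
        map_natCast, map_ofNat, Nat.cast_add, Nat.cast_mul, Nat.cast_ofNat, Nat.cast_one, map_one]
      ring
    · rw [if_pos (by omega)]
      have hq' : 2 * m + (q + 1 + 1) - 2 * (m + 1) = q := by omega
      rw [hq']
      have hrec : 4 * ((m : ℝ) + 1) * ((2 * m + (q + 2)) - (m + 1) + L + 1) * c (m + 1) =
          - ((q + 1) * (q + 2)) * c m := by
        simp only [hc]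
        have e1 : L + (2 * m + (q + 1 + 1)) - m = L + m + q + 1 + 1 := by omega
        have e2 : L + (2 * m + (q + 1 + 1)) - (m + 1) = L + m + q + 1 := by omega
        rw [hq, hq', e1, e2]
        have := Nat.factorial_ne_zero L
        have := Nat.factorial_ne_zero m
        have := Nat.factorial_ne_zero q
        simp only [Nat.factorial_succ, pow_succ, Nat.cast_mul, Nat.cast_add, Nat.cast_one]
        field_simp
        ring
      have hrec' := congrArg (C : ℝ → ℝ[X]) hrec
      simp only [derivative_C_mul, derivative_X_pow, derivative_natCast_mul, Nat.add_sub_cancel, map_mul, map_add, map_sub,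
        map_neg, map_natCast, map_ofNat, map_one] at hrec' ⊢
      push_cast at hrec' ⊢
      linear_combination X ^ q * hrec'
  have hsum := Finset.sum_congr rfl hstep
  rw [Finset.sum_range_sub'] at hsum
  have h0 : T 0 = 0 := by simp [hT]
  have h1 : T (N / 2 + 1) = 0 := by simp only [hT]; rw [if_neg (by omega)]
  rw [h0, h1] at hsum
  rw [Finset.sum_add_distrib, Finset.sum_sub_distrib, ← Finset.mul_sum, ← Finset.mul_sum,
    ← Finset.mul_sum, ← derivative_sum, ← derivative_sum] at hsum
  change (1 - X ^ 2) * derivative (derivative (gegenbauerPoly L N)) -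
      C (2 * L + 3 : ℝ) * X * derivative (gegenbauerPoly L N) +
        C (N * (N + 2 * L + 2) : ℝ) * gegenbauerPoly L N = _ at hsum
  linear_combination hsum

open Polynomial in
/-- Left side of the third-order differential equation satisfied by the square of the Gegenbauer
polynomial with parameter `l` and degree `N`. -/
noncomputable def symSquareOp (l N : ℝ) (g : ℝ[X]) : ℝ[X] :=
  (1 - X ^ 2) ^ 2 * derivative (derivative (derivative g)) -
    C (6 * l + 3) * X * (1 - X ^ 2) * derivative (derivative g) +
    (C (4 * (N * (N + 2 * l)) - 2 * l - 1) * (1 - X ^ 2) + C (4 * l * (2 * l + 1)) * X ^ 2) *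
      derivative g - C (8 * l * (N * (N + 2 * l))) * X * g

open Polynomial in
theorem symSquareOp_sub (l N : ℝ) (g h : ℝ[X]) :
    symSquareOp l N (g - h) = symSquareOp l N g - symSquareOp l N h := by
  simp only [symSquareOp, derivative_sub]
  ring

open Polynomial in
theorem symSquareOp_gegenbauerPoly_sq (L N : ℕ) :
    symSquareOp (L + 1) N (gegenbauerPoly L N ^ 2) = 0 := by
  have e := gegenbauerPoly_ode L N
  have e' := congrArg derivative e
  simp only [symSquareOp]
  generalize gegenbauerPoly L N = f at *
  simp only [derivative_mul, derivative_one, derivative_X, map_mul, map_add, map_sub, map_natCast, map_ofNat, map_one,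
    derivative_natCast, derivative_ofNat, pow_two] at e e' ⊢
  linear_combination (6 * (1 - X ^ 2) * derivative f - 8 * (L + 1) * X * f) * e +
    2 * f * (1 - X ^ 2) * e'

open Polynomial in
theorem eq_zero_of_symSquareOp_eq_zero (L N : ℕ) (d : ℝ[X])
    (hd : symSquareOp (L + 1) N d = 0) (h0 : d.coeff (2 * N) = 0) : d = 0 := by
  by_contra hne
  set p := d.natDegree with hp
  have hlead : d.coeff p ≠ 0 := by simpa [hp] using hne
  have hvan : ∀ i, p < i → d.coeff i = 0 := fun i hi => coeff_eq_zero_of_natDegree_lt hi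
  have c1 : ∀ i, (X * derivative d).coeff i = i * d.coeff i := by
    rintro (_ | i)
    · simp
    · rw [coeff_X_mul, coeff_derivative]; push_cast; ring
  have c2 : ∀ i, (X ^ 2 * derivative (derivative d)).coeff i = i * (i - 1) * d.coeff i := by
    rintro (_ | _ | i)
    · simp
    · simp [coeff_X_pow_mul']
    · rw [coeff_X_pow_mul, coeff_derivative, coeff_derivative]; push_cast; ring
  have c3 : ∀ i, (X ^ 3 * derivative (derivative (derivative d))).coeff i =
      i * (i - 1) * (i - 2) * d.coeff i := by
    rintro (_ | _ | _ | i)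
    · simp
    · simp [coeff_X_pow_mul']
    · simp [coeff_X_pow_mul']
    · rw [coeff_X_pow_mul, coeff_derivative, coeff_derivative, coeff_derivative]; push_cast; ring
  set l : ℝ := L + 1 with hl
  set v : ℝ := N * (N + 2 * l) with hv
  have key : X ^ 3 * symSquareOp l N d =
      X ^ 3 * derivative (derivative (derivative d)) +
      X ^ 2 * (C (-2) * (X ^ 3 * derivative (derivative (derivative d))) -
        C (6 * l + 3) * (X ^ 2 * derivative (derivative d)) +
        C (4 * v - 2 * l - 1) * (X * derivative d)) +
      X ^ 4 * (X ^ 3 * derivative (derivative (derivative d)) +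
        C (6 * l + 3) * (X ^ 2 * derivative (derivative d)) +
        C (4 * l * (2 * l + 1) - (4 * v - 2 * l - 1)) * (X * derivative d) - C (8 * l * v) * d) := by
    simp only [symSquareOp, map_sub, map_neg, ← hv, map_ofNat]
    ring
  rw [hd, mul_zero] at key
  have k := congrArg (fun q => coeff q (p + 4)) key
  simp only [coeff_zero, coeff_add] at k
  have x2 (e : ℝ[X]) : (X ^ 2 * e).coeff (p + 4) = e.coeff (p + 2) := coeff_X_pow_mul e 2 (p + 2)
  have x4 (e : ℝ[X]) : (X ^ 4 * e).coeff (p + 4) = e.coeff p := coeff_X_pow_mul e 4 p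
  rw [x2, x4] at k
  simp only [coeff_add, coeff_sub, coeff_C_mul, c1, c2, c3, hvan (p + 4) (by omega),
    hvan (p + 2) (by omega)] at k
  have k' : ((p : ℝ) - 2 * N) * ((p + 2 * l) * (p + 2 * N + 4 * l)) * d.coeff p = 0 := by
    rw [hv] at k
    linear_combination -k
  have hl0 : 0 < l := by positivity
  have hpos : ((p : ℝ) + 2 * l) * (p + 2 * N + 4 * l) ≠ 0 := by positivity
  have hpN : (p : ℝ) - 2 * N = 0 := by
    simpa [hlead, hpos] using k'
  have : p = 2 * N := by
    have : (p : ℝ) = (2 * N : ℕ) := by push_cast; linarith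
    exact_mod_cast this
  exact hlead (this ▸ h0)

/-- Coefficient of `(1 - y ^ 2) ^ m` in the square of the Gegenbauer polynomial. -/
noncomputable def gegenbauerSqCoeff (L N m : ℕ) : ℝ :=
  (-4) ^ m * (N + 2 * L + 1).factorial * (N + 2 * L + m + 1).factorial * (L + m).factorial ^ 2 *
    N.choose m / (N.factorial ^ 2 * (2 * L + m + 1).factorial * (2 * L + 2 * m + 1).factorial *
      L.factorial ^ 2)

theorem cast_choose_succ_right (m j : ℕ) :
    (m.choose (j + 1) : ℝ) = m.choose j * (m - j) / (j + 1) := by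
  rw [eq_div_iff (by positivity)]
  rcases le_or_gt j m with h | h
  · have h2 := congrArg (Nat.cast : ℕ → ℝ) (Nat.choose_succ_right_eq m j)
    push_cast [Nat.cast_sub h] at h2
    exact h2
  · rw [Nat.choose_eq_zero_of_lt h, Nat.choose_eq_zero_of_lt (by omega)]; simp

theorem gegenbauerSqCoeff_succ (L N m : ℕ) :
    8 * ((m : ℝ) + 1) * (m + 2 * (L + 1)) * (m + (L + 1) + 1 / 2) *
      gegenbauerSqCoeff L N (m + 1) =
    8 * ((m : ℝ) - N) * (m + (L + 1)) * (m + N + 2 * (L + 1)) * gegenbauerSqCoeff L N m := by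
  unfold gegenbauerSqCoeff
  rw [cast_choose_succ_right]
  rw [show 2 * L + 2 * (m + 1) + 1 = 2 * L + 2 * m + 1 + 1 + 1 by ring,
    show N + 2 * L + (m + 1) + 1 = N + 2 * L + m + 1 + 1 by ring,
    show 2 * L + (m + 1) + 1 = 2 * L + m + 1 + 1 by ring, ← add_assoc L m 1]
  rw [Nat.factorial_succ (N + 2 * L + m + 1), Nat.factorial_succ (2 * L + m + 1),
    Nat.factorial_succ (2 * L + 2 * m + 1 + 1), Nat.factorial_succ (2 * L + 2 * m + 1),
    Nat.factorial_succ (L + m), pow_succ]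
  have := Nat.factorial_ne_zero N
  have := Nat.factorial_ne_zero L
  have := Nat.factorial_ne_zero (2 * L + m + 1)
  have := Nat.factorial_ne_zero (2 * L + 2 * m + 1)
  push_cast
  field_simp
  ring

open Polynomial in
theorem symSquareOp_one_sub_X_sq_pow (l N : ℝ) (m : ℕ) :
    (1 - X ^ 2) * symSquareOp l N ((1 - X ^ 2) ^ m) =
      X * (C (8 * (m - N) * (m + l) * (m + N + 2 * l)) * (1 - X ^ 2) ^ (m + 1) -
        C (8 * m * (m - 1 + 2 * l) * (m - 1 + l + 1 / 2)) * (1 - X ^ 2) ^ m) := by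
  have e1 : (1 - X ^ 2 : ℝ[X]) * derivative ((1 - X ^ 2 : ℝ[X]) ^ m) =
      -(2 * (m : ℝ[X]) * X * (1 - X ^ 2) ^ m) := by
    rcases m with _ | m
    · simp
    · simp only [derivative_pow, derivative_sub, derivative_one, derivative_X, Nat.add_sub_cancel,
        map_natCast]
      push_cast
      ring
  have hc : (C (8 * m * (m - 1 + 2 * l) * (m - 1 + l + 1 / 2)) : ℝ[X]) =
      C (4 * m * (m - 1 + 2 * l) * (2 * m - 1 + 2 * l)) := by congr 1; ring
  rw [pow_succ _ m, hc]
  simp only [symSquareOp]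
  generalize (1 - X ^ 2 : ℝ[X]) ^ m = P at e1 ⊢
  have e2 := congrArg derivative e1
  have e3 := congrArg derivative e2
  simp only [derivative_mul, derivative_one, derivative_X, map_mul, map_add, map_sub, map_natCast, map_ofNat, map_one,
    derivative_natCast, derivative_ofNat, derivative_neg, derivative_zero, pow_two] at e1 e2 e3 ⊢
  linear_combination (1 - X ^ 2) ^ 2 * e3 +
    (4 - 2 * (m : ℝ[X]) - (6 * C l + 3)) * X * (1 - X ^ 2) * e2 +
    ((2 - 4 * (m : ℝ[X])) * (1 - X ^ 2) +
      (4 - 2 * (m : ℝ[X]) - (6 * C l + 3)) * (2 - 2 * (m : ℝ[X])) * X ^ 2 +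
      (4 * (C N * (C N + 2 * C l)) - 2 * C l - 1) * (1 - X ^ 2) +
      4 * C l * (2 * C l + 1) * X ^ 2) * e1

open Polynomial in
theorem symSquareOp_sum (l N : ℝ) (s : Finset ℕ) (b : ℕ → ℝ) (g : ℕ → ℝ[X]) :
    symSquareOp l N (∑ m ∈ s, C (b m) * g m) = ∑ m ∈ s, C (b m) * symSquareOp l N (g m) := by
  simp only [symSquareOp, derivative_sum, derivative_C_mul, Finset.mul_sum,
    ← Finset.sum_sub_distrib, ← Finset.sum_add_distrib]
  exact Finset.sum_congr rfl fun m _ => by ring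

open Polynomial in
theorem symSquareOp_sum_gegenbauerSqCoeff (L N : ℕ) :
    symSquareOp (L + 1) N
      (∑ m ∈ Finset.range (N + 1), C (gegenbauerSqCoeff L N m) * (1 - X ^ 2) ^ m) = 0 := by
  have hu : (1 - X ^ 2 : ℝ[X]) ≠ 0 := by
    intro h
    simpa using congrArg (eval 0) h
  apply mul_left_cancel₀ hu
  rw [mul_zero, symSquareOp_sum, Finset.mul_sum]
  set T : ℕ → ℝ[X] := fun m =>
    X * (C (8 * m * (m - 1 + 2 * (L + 1)) * (m - 1 + (L + 1) + 1 / 2) * gegenbauerSqCoeff L N m) *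
      (1 - X ^ 2) ^ m) with hT
  have hstep : ∀ m ∈ Finset.range (N + 1), (1 - X ^ 2) * (C (gegenbauerSqCoeff L N m) *
      symSquareOp (L + 1) N ((1 - X ^ 2) ^ m)) = T (m + 1) - T m := by
    intro m _
    have h := symSquareOp_one_sub_X_sq_pow (L + 1) N m
    have hr := congrArg (C : ℝ → ℝ[X]) (gegenbauerSqCoeff_succ L N m)
    simp only [hT]
    rw [show ((m + 1 : ℕ) : ℝ) - 1 = m by push_cast; ring, Nat.cast_succ, hr, C_mul,
      C_mul (b := gegenbauerSqCoeff L N m)]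
    linear_combination C (gegenbauerSqCoeff L N m) * h
  rw [Finset.sum_congr rfl hstep, Finset.sum_range_sub]
  simp [hT, gegenbauerSqCoeff]

open Polynomial in
/-- Clausen's formula for the square of a Gegenbauer polynomial. -/
theorem gegenbauerPoly_sq (L N : ℕ) :
    gegenbauerPoly L N ^ 2 =
      ∑ m ∈ Finset.range (N + 1), C (gegenbauerSqCoeff L N m) * (1 - X ^ 2) ^ m := by
  rw [← sub_eq_zero]
  apply eq_zero_of_symSquareOp_eq_zero L N
  · rw [symSquareOp_sub, symSquareOp_gegenbauerPoly_sq, symSquareOp_sum_gegenbauerSqCoeff, sub_zero]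
  have hdeg : (gegenbauerPoly L N).natDegree ≤ N :=
    natDegree_sum_le_of_forall_le _ _ fun m _ =>
      (natDegree_C_mul_X_pow_le _ _).trans (Nat.sub_le _ _)
  have hcoeff : (gegenbauerPoly L N).coeff N =
      (L + N).factorial / (L.factorial * N.factorial) * 2 ^ N := by
    rw [gegenbauerPoly, finsetSum_coeff, Finset.sum_eq_single 0]
    · simp only [mul_zero, Nat.sub_zero, coeff_C_mul, coeff_X_pow_self]
      simp
    · intro m hm hm0
      have := Finset.mem_range.1 hm
      rw [coeff_C_mul, coeff_X_pow, if_neg (by omega), mul_zero]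
    · simp
  have hu : (1 - X ^ 2 : ℝ[X]).natDegree ≤ 2 := by compute_degree
  rw [coeff_sub, pow_two, two_mul, coeff_mul_add_eq_of_natDegree_le hdeg hdeg, hcoeff, finsetSum_coeff,
    Finset.sum_eq_single N]
  · have hN := coeff_pow_of_natDegree_le (n := 2) (m := N) hu
    rw [← two_mul, coeff_C_mul, mul_comm 2 N, hN]
    have h2 : (1 - X ^ 2 : ℝ[X]).coeff 2 = -1 := by simp [coeff_one]
    rw [h2, gegenbauerSqCoeff, Nat.choose_self, show 2 * L + N + 1 = N + 2 * L + 1 by ring,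
      show N + 2 * L + N + 1 = 2 * L + 2 * N + 1 by ring]
    have := Nat.factorial_ne_zero N
    have := Nat.factorial_ne_zero L
    have := Nat.factorial_ne_zero (N + 2 * L + 1)
    have := Nat.factorial_ne_zero (2 * L + 2 * N + 1)
    have h4 : (-4 : ℝ) ^ N * (-1) ^ N = 2 ^ N * 2 ^ N := by
      rw [← mul_pow, ← mul_pow]; norm_num
    field_simp
    push_cast
    linear_combination -((L + N).factorial : ℝ) ^ 2 * h4
  · intro m hm hm0
    have := Finset.mem_range.1 hm
    rw [coeff_C_mul, coeff_eq_zero_of_natDegree_lt, mul_zero]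
    refine (natDegree_pow_le_of_le m hu).trans_lt ?_
    omega
  · simp

theorem gegenbauer_eq_eval (L N : ℕ) (y : ℝ) :
    gegenbauer (L + 1) N y = (gegenbauerPoly L N).eval y := by
  rw [gegenbauer, gegenbauerPoly, Polynomial.eval_finsetSum]
  refine Finset.sum_congr rfl fun m hm => ?_
  have hm' : m ≤ N := by have := Finset.mem_range.1 hm; omega
  have e : (L : ℝ) + 1 + N - m = ((L + N - m : ℕ) : ℝ) + 1 := by
    rw [Nat.cast_sub (by omega)]; push_cast; ring
  rw [e, Real.Gamma_nat_eq_factorial, Real.Gamma_nat_eq_factorial, Polynomial.eval_mul,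
    Polynomial.eval_C, Polynomial.eval_pow, Polynomial.eval_X, mul_pow]
  ring

theorem gegenbauer_sq (L N : ℕ) (y : ℝ) :
    gegenbauer (L + 1) N y ^ 2 =
      ∑ m ∈ Finset.range (N + 1), gegenbauerSqCoeff L N m * (1 - y ^ 2) ^ m := by
  rw [gegenbauer_eq_eval, ← Polynomial.eval_pow, gegenbauerPoly_sq, Polynomial.eval_finsetSum]
  simp

theorem rbinom_natCast (n m : ℕ) : rbinom n m = n.choose m := by
  rw [rbinom, ← descPochhammer_eval_eq_prod_range, descPochhammer_eval_eq_descFactorial,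
    Nat.descFactorial_eq_factorial_mul_choose]
  push_cast
  field_simp

theorem sum_choose_mul_choose_mul_choose (a j p : ℕ) (hp : p ≤ j) :
    (∑ m ∈ Finset.range (j + 1),
      if m ≤ p then (j + a).choose (j - m) * j.choose m * (j - m).choose (p - m) else 0) =
      (j + a + p).choose (a + 2 * p) * (a + 2 * p).choose p := by
  have h1 : ∀ m ∈ Finset.range (j + 1),
      (if m ≤ p then (j + a).choose (j - m) * j.choose m * (j - m).choose (p - m) else 0) =
        j.choose p * (p.choose m * (j + a).choose (j - m)) := by
    intro m _
    split_ifs with h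
    · rw [mul_assoc, ← Nat.choose_mul h]
      ring
    · rw [Nat.choose_eq_zero_of_lt (not_le.1 h)]; simp
  have h2 := Nat.add_choose_eq p (j + a) j
  rw [Finset.Nat.sum_antidiagonal_eq_sum_range_succ_mk] at h2
  rw [Finset.sum_congr rfl h1, ← Finset.mul_sum, ← h2, Nat.choose_mul (by omega : p ≤ a + 2 * p),
    mul_comm, show p + (j + a) = j + a + p by ring, Nat.choose_mul hp,
    show j + a + p - p = j + a by omega, show a + 2 * p - p = a + p by omega,
    Nat.choose_symm_of_eq_add (by omega : j + a = (j - p) + (a + p))]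

theorem pow_mul_one_add_pow (v : ℝ) (j m : ℕ) (hm : m ≤ j) :
    v ^ m * (1 + v) ^ (j - m) =
      ∑ p ∈ Finset.range (j + 1), if m ≤ p then ((j - m).choose (p - m) : ℝ) * v ^ p else 0 := by
  obtain ⟨r, rfl⟩ := Nat.exists_eq_add_of_le hm
  rw [add_assoc, Finset.sum_range_add, Nat.add_sub_cancel_left, add_comm (1 : ℝ), add_pow,
    Finset.mul_sum, Finset.sum_eq_zero (s := Finset.range m), zero_add]
  · refine Finset.sum_congr rfl fun q _ => ?_
    rw [if_pos (by omega), Nat.add_sub_cancel_left, one_pow, pow_add]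
    ring
  · intro p hp
    rw [if_neg (by simpa using hp)]

theorem jacobi_eq_sum (a j : ℕ) (v : ℝ) :
    jacobi a 0 j (2 * v + 1) = ∑ p ∈ Finset.range (j + 1),
      ((j + a + p).choose (a + 2 * p) : ℝ) * (a + 2 * p).choose p * v ^ p := by
  have h1 : ∀ m ∈ Finset.range (j + 1),
      rbinom ((j : ℝ) + a) (j - m) * rbinom ((j : ℝ) + 0) m *
        ((2 * v + 1 - 1) / 2) ^ m * ((2 * v + 1 + 1) / 2) ^ (j - m) =
      ∑ p ∈ Finset.range (j + 1), ((if m ≤ p then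
        (j + a).choose (j - m) * j.choose m * (j - m).choose (p - m) else 0 : ℕ) : ℝ) * v ^ p := by
    intro m hm
    rw [add_zero, ← Nat.cast_add, rbinom_natCast, rbinom_natCast,
      show (2 * v + 1 - 1) / 2 = v by ring, show (2 * v + 1 + 1) / 2 = 1 + v by ring, mul_assoc,
      pow_mul_one_add_pow v j m (by have := Finset.mem_range.1 hm; omega), Finset.mul_sum]
    refine Finset.sum_congr rfl fun p _ => ?_
    split_ifs <;> push_cast <;> ring
  rw [jacobi, Finset.sum_congr rfl h1, Finset.sum_comm]
  refine Finset.sum_congr rfl fun p hp => ?_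
  rw [← Finset.sum_mul, ← Nat.cast_sum, sum_choose_mul_choose_mul_choose a j p
    (by have := Finset.mem_range.1 hp; omega), Nat.cast_mul]

theorem sum_range_choose_add (a p n : ℕ) :
    ∑ j ∈ Finset.range (n + 1), (j + a + p).choose (a + 2 * p) =
      (n + a + p + 1).choose (a + 2 * p + 1) := by
  induction n with
  | zero =>
    rw [Finset.sum_range_one, Nat.choose_succ_succ, zero_add,
      Nat.choose_eq_zero_of_lt (by omega : a + p < a + 2 * p + 1), add_zero]
  | succ n ih =>
    rw [Finset.sum_range_succ, ih, show n + 1 + a + p = n + a + p + 1 by ring,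
      Nat.choose_succ_succ (n + a + p + 1), add_comm]

theorem sum_jacobi_eq_sum (a n : ℕ) (v : ℝ) :
    ∑ j ∈ Finset.range (n + 1), jacobi a 0 j (2 * v + 1) = ∑ p ∈ Finset.range (n + 1),
      ((n + a + p + 1).choose (a + 2 * p + 1) : ℝ) * (a + 2 * p).choose p * v ^ p := by
  have h1 : ∀ j ∈ Finset.range (n + 1), jacobi a 0 j (2 * v + 1) = ∑ p ∈ Finset.range (n + 1),
      ((j + a + p).choose (a + 2 * p) : ℝ) * ((a + 2 * p).choose p * v ^ p) := by
    intro j hj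
    rw [jacobi_eq_sum]
    simp only [mul_assoc]
    refine Finset.sum_subset (Finset.range_subset_range.2 (by simpa using hj)) fun p _ hp => ?_
    rw [Nat.choose_eq_zero_of_lt (by simp at hp; omega)]
    simp
  rw [Finset.sum_congr rfl h1, Finset.sum_comm]
  refine Finset.sum_congr rfl fun p _ => ?_
  rw [← Finset.sum_mul, ← sum_range_choose_add, mul_assoc, Nat.cast_sum]

/-- A very-well-poised hypergeometric sum. -/
theorem sum_wellPoised (k M : ℕ) : ∀ p : ℕ, p < 2 * M →
    ∑ i ∈ Finset.range M, (4 * (i : ℝ) + 2 * k + 1) * 4 ^ p / 16 ^ i * i.centralBinom *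
      (k + i).centralBinom * (2 * i).factorial * p.choose (2 * i) /
        (2 * i + 2 * k + p + 1).factorial =
      (2 * k + 2 * p).factorial / ((2 * k + p).factorial * (k + p).factorial ^ 2) := by
  intro p
  induction p with
  | zero =>
    intro hM
    rw [Finset.sum_eq_single_of_mem 0 (Finset.mem_range.2 (by omega))]
    · have h := Nat.cast_add_choose ℝ (a := k) (b := k)
      rw [← two_mul, ← Nat.centralBinom_eq_two_mul_choose] at h
      have := Nat.factorial_ne_zero (2 * k)
      have := Nat.factorial_ne_zero k
      simp [h, Nat.factorial_succ]
      field_simp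
    · intro i _ hi
      rw [Nat.choose_eq_zero_of_lt (by omega)]
      simp
  | succ p ih =>
    intro hM
    have ih := ih (by omega)
    set G : ℕ → ℝ := fun i => -8 * i * (k + i) * 4 ^ p / 16 ^ i * i.centralBinom *
      (k + i).centralBinom * (2 * i).factorial * (p + 1).choose (2 * i) /
        ((2 * k + p + 1) * (k + p + 1) * (p + 1) * (2 * i + 2 * k + p).factorial) with hG
    have hstep : ∀ i ∈ Finset.range M,
        (4 * (i : ℝ) + 2 * k + 1) * 4 ^ (p + 1) / 16 ^ i * i.centralBinom *
      (k + i).centralBinom * (2 * i).factorial * (p + 1).choose (2 * i) /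
        (2 * i + 2 * k + (p + 1) + 1).factorial =
        2 * (2 * k + 2 * p + 1) / ((2 * k + p + 1) * (k + p + 1)) *
        ((4 * (i : ℝ) + 2 * k + 1) * 4 ^ p / 16 ^ i * i.centralBinom *
      (k + i).centralBinom * (2 * i).factorial * p.choose (2 * i) /
        (2 * i + 2 * k + p + 1).factorial) + (G (i + 1) - G i) := by
      intro i _
      have hp : (p.choose (2 * i) : ℝ) = (p + 1).choose (2 * i) * (p + 1 - 2 * i) / (p + 1) := by
        rw [eq_div_iff (by positivity)]
        rcases le_or_gt (2 * i) (p + 1) with h | h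
        · have h2 := congrArg (Nat.cast : ℕ → ℝ) (Nat.choose_mul_succ_eq p (2 * i))
          push_cast [Nat.cast_sub h] at h2
          exact h2
        · rw [Nat.choose_eq_zero_of_lt h, Nat.choose_eq_zero_of_lt (by omega)]; simp
      have hb : ∀ m : ℕ, ((m + 1).centralBinom : ℝ) = 2 * (2 * m + 1) * m.centralBinom / (m + 1) := by
        intro m
        rw [eq_div_iff (by positivity)]
        have h2 := congrArg (Nat.cast : ℕ → ℝ) (Nat.succ_mul_centralBinom_succ m)
        push_cast at h2
        linarith
      simp only [hG]
      rw [show 2 * (i + 1) = 2 * i + 1 + 1 by ring, cast_choose_succ_right,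
        cast_choose_succ_right, hp, ← add_assoc k i 1, hb, hb,
        show 2 * i + 1 + 1 + 2 * k + p = 2 * i + 2 * k + p + 1 + 1 by ring,
        show 2 * i + 2 * k + (p + 1) + 1 = 2 * i + 2 * k + p + 1 + 1 by ring]
      simp only [Nat.factorial_succ]
      have := Nat.factorial_ne_zero (2 * i + 2 * k + p)
      push_cast
      field_simp
      ring
    rw [Finset.sum_congr rfl hstep, Finset.sum_add_distrib, ← Finset.mul_sum, ih,
      Finset.sum_range_sub]
    have hM0 : G M = 0 := by
      simp only [hG]
      rw [Nat.choose_eq_zero_of_lt hM]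
      simp
    have h00 : G 0 = 0 := by simp [hG]
    rw [hM0, h00, show 2 * k + 2 * (p + 1) = 2 * k + 2 * p + 1 + 1 by ring, ← add_assoc,
      ← add_assoc]
    simp only [Nat.factorial_succ]
    have := Nat.factorial_ne_zero (2 * k + p)
    have := Nat.factorial_ne_zero (k + p)
    push_cast
    field_simp
    ring

theorem ascPochhammer_eval_half (k : ℕ) :
    (ascPochhammer ℝ k).eval (1 / 2 : ℝ) = k.centralBinom * k.factorial / 4 ^ k := by
  induction k with
  | zero => simp
  | succ k ih =>
    have h2 := congrArg (Nat.cast : ℕ → ℝ) (Nat.succ_mul_centralBinom_succ k)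
    push_cast at h2
    rw [ascPochhammer_succ_eval, ih, Nat.factorial_succ]
    push_cast
    field_simp
    linear_combination -2 * 4 ^ k * h2

theorem Gamma_half_add_nat (k : ℕ) :
    Real.Gamma (1 / 2 + k) = (ascPochhammer ℝ k).eval (1 / 2 : ℝ) * Real.Gamma (1 / 2) := by
  induction k with
  | zero => simp
  | succ k ih =>
    rw [ascPochhammer_succ_eval, Nat.cast_succ, ← add_assoc, Real.Gamma_add_one (by positivity), ih]
    ring

theorem gegenbauer_odd_zero (ν : ℝ) (i : ℕ) : gegenbauer ν (2 * i + 1) 0 = 0 := by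
  refine Finset.sum_eq_zero fun m hm => ?_
  have := Finset.mem_range.1 hm
  rw [mul_zero, zero_pow (by omega), mul_zero]

theorem ascPochhammer_mul_gegenbauer_even_zero (k i : ℕ) :
    (ascPochhammer ℝ k).eval (1 / 2 : ℝ) * gegenbauer (1 / 2 + k) (2 * i) 0 =
      (-1) ^ i * ((k + i).centralBinom * (k + i).factorial / (4 ^ (k + i) * i.factorial)) := by
  have hk : (0 : ℝ) < Real.Gamma (1 / 2 + k) := Real.Gamma_pos_of_pos (by positivity)
  have hh : (0 : ℝ) < Real.Gamma (1 / 2) := Real.Gamma_pos_of_pos (by positivity)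
  rw [gegenbauer, Finset.sum_eq_single i]
  · have e : (1 / 2 + (k : ℝ)) + ((2 * i : ℕ) : ℝ) - i = 1 / 2 + ((k + i : ℕ) : ℝ) := by
      push_cast; ring
    have hk' := Gamma_half_add_nat k
    rw [e, Gamma_half_add_nat (k + i), ascPochhammer_eval_half (k + i)]
    simp only [Nat.sub_self, mul_zero, pow_zero, Nat.factorial_zero, Nat.cast_one]
    have := Nat.factorial_ne_zero i
    generalize Real.Gamma (1 / 2 + k) = g at hk hk' ⊢
    field_simp
    rw [hk']
    ring
  · intro m hm hmi
    have := Finset.mem_range.1 hm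
    rw [mul_zero, zero_pow (by omega), mul_zero]
  · intro h
    exact absurd (Finset.mem_range.2 (by omega)) h

theorem sum_range_two_mul (f : ℕ → ℝ) (M : ℕ) :
    ∑ j ∈ Finset.range (2 * M), f j = ∑ i ∈ Finset.range M, (f (2 * i) + f (2 * i + 1)) := by
  induction M with
  | zero => simp
  | succ M ih =>
    rw [show 2 * (M + 1) = 2 * M + 1 + 1 by ring, Finset.sum_range_succ, Finset.sum_range_succ, ih,
      Finset.sum_range_succ, add_assoc]

theorem sum_gegenbauer_zero_sq (k n p : ℕ) (hp : p ≤ n) :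
    ∑ j ∈ Finset.range (n + 1), (-1) ^ j * (2 * (j : ℝ) + 2 * k + 1) * j.factorial ^ 2 *
      ((ascPochhammer ℝ k).eval (1 / 2 : ℝ) * gegenbauer (1 / 2 + k) j 0) ^ 2 * p.choose j /
        ((j + 2 * k).factorial * (j + 2 * k + p + 1).factorial) =
      ((2 * k + 2 * p).factorial : ℝ) /
        (16 ^ k * 4 ^ p * (2 * k + p).factorial * (k + p).factorial ^ 2) := by
  have hext : Finset.range (n + 1) ⊆ Finset.range (2 * (n + 1)) :=
    Finset.range_subset_range.2 (by omega)
  rw [Finset.sum_subset hext, sum_range_two_mul]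
  · trans (16 ^ k * 4 ^ p : ℝ)⁻¹ *
      ((2 * k + 2 * p).factorial / ((2 * k + p).factorial * (k + p).factorial ^ 2))
    swap
    · field_simp
    rw [← sum_wellPoised k (n + 1) p (by omega), Finset.mul_sum]
    refine Finset.sum_congr rfl fun i _ => ?_
    rw [gegenbauer_odd_zero, ascPochhammer_mul_gegenbauer_even_zero]
    have hb (m : ℕ) : (m.centralBinom : ℝ) = (2 * m).factorial / (m.factorial * m.factorial) := by
      rw [Nat.centralBinom_eq_two_mul_choose, two_mul, Nat.cast_add_choose]
    have hb1 := hb i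
    have hb2 := hb (k + i)
    rw [mul_add, add_comm (2 * k)] at hb2
    have := Nat.factorial_ne_zero i
    have := Nat.factorial_ne_zero (k + i)
    have := Nat.factorial_ne_zero (2 * i + 2 * k)
    have := Nat.factorial_ne_zero (2 * i + 2 * k + p + 1)
    have e1 : ((-1 : ℝ) ^ i) ^ 2 = 1 := by rw [← pow_mul, mul_comm, pow_mul]; simp
    have e2 : ((4 : ℝ) ^ (k + i)) ^ 2 = 16 ^ k * 16 ^ i := by
      rw [← pow_mul, mul_comm, pow_mul, pow_add]; norm_num
    have e3 : (-1 : ℝ) ^ (2 * i) = 1 := by rw [pow_mul]; simp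
    simp only [mul_pow, div_pow, e1, e2, e3]
    rw [hb1, hb2]
    push_cast
    field_simp
    ring
  · intro j _ hj
    rw [Nat.choose_eq_zero_of_lt (by simp at hj; omega)]
    simp


theorem askey_gasper_term (k j q r : ℕ) (g : ℝ) :
    (2 * (j : ℝ) + 2 * k + 1) *
        (4 ^ (j + 2 * k) * ((j + k).factorial : ℝ) ^ 2 * ((q + r).factorial : ℝ) *
          (j.factorial : ℝ) * ((ascPochhammer ℝ k).eval (1 / 2 : ℝ)) ^ 2) /
        (((2 * k + (j + q + r) + j + 1).factorial : ℝ) * ((j + 2 * k).factorial : ℝ)) * g ^ 2 *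
      gegenbauerSqCoeff (j + k) (q + r) q =
    (-1) ^ (j + q) * 4 ^ (2 * k + (j + q)) * (j + q + r + 2 * k + (j + q) + 1).factorial *
        (k + (j + q)).factorial ^ 2 /
        (r.factorial * (j + q).factorial * (2 * k + 2 * (j + q) + 1).factorial) *
      ((-1) ^ j * (2 * (j : ℝ) + 2 * k + 1) * j.factorial ^ 2 *
        ((ascPochhammer ℝ k).eval (1 / 2 : ℝ) * g) ^ 2 * (j + q).choose j /
        ((j + 2 * k).factorial * (j + 2 * k + (j + q) + 1).factorial)) := by
  rw [gegenbauerSqCoeff, Nat.cast_add_choose, Nat.cast_add_choose,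
    show q + r + 2 * (j + k) + 1 = 2 * k + (j + q + r) + j + 1 by ring,
    show q + r + 2 * (j + k) + q + 1 = j + q + r + 2 * k + (j + q) + 1 by ring,
    show j + k + q = k + (j + q) by ring,
    show 2 * (j + k) + q + 1 = j + 2 * k + (j + q) + 1 by ring,
    show 2 * (j + k) + 2 * q + 1 = 2 * k + 2 * (j + q) + 1 by ring]
  have h1 : (-1 : ℝ) ^ (j + q) * (-1) ^ j = (-1) ^ q := by
    rw [pow_add, mul_right_comm, ← pow_add, ← two_mul, pow_mul]
    simp
  have h2 : (-4 : ℝ) ^ q = (-1) ^ q * 4 ^ q := by rw [← mul_pow]; norm_num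
  rw [h2, ← h1]
  have := Nat.factorial_ne_zero
  field_simp
  ring

theorem askey_gasper_coeff (k n p : ℕ) (hp : p ≤ n) :
    (-1) ^ p * 4 ^ (2 * k + p) * (n + 2 * k + p + 1).factorial * (k + p).factorial ^ 2 /
        ((n - p).factorial * p.factorial * (2 * k + 2 * p + 1).factorial) *
      (((2 * k + 2 * p).factorial : ℝ) /
        (16 ^ k * 4 ^ p * (2 * k + p).factorial * (k + p).factorial ^ 2)) =
    ((n + 2 * k + p + 1).choose (2 * k + 2 * p + 1) : ℝ) * (2 * k + 2 * p).choose p * (-1) ^ p := by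
  obtain ⟨r, rfl⟩ := Nat.exists_eq_add_of_le hp
  have h1 : ((p + r + 2 * k + p + 1).choose (2 * k + 2 * p + 1) : ℝ) =
      (p + r + 2 * k + p + 1).factorial / ((2 * k + 2 * p + 1).factorial * r.factorial) := by
    rw [show p + r + 2 * k + p + 1 = 2 * k + 2 * p + 1 + r by ring, Nat.cast_add_choose]
  have h2 : ((2 * k + 2 * p).choose p : ℝ) =
      (2 * k + 2 * p).factorial / (p.factorial * (2 * k + p).factorial) := by
    rw [show 2 * k + 2 * p = p + (2 * k + p) by ring, Nat.cast_add_choose]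
  have h3 : (16 : ℝ) ^ k = 4 ^ (2 * k) := by rw [pow_mul]; norm_num
  rw [h1, h2, h3, Nat.add_sub_cancel_left, pow_add]
  have := Nat.factorial_ne_zero
  field_simp

theorem askey_gasper_sum (k n : ℕ) (y : ℝ) :
    (∑ j ∈ Finset.range (n + 1), jacobi (2 * k) 0 j (2 * y ^ 2 - 1)) =
        ∑ j ∈ Finset.range (n + 1),
          (2 * (j : ℝ) + 2 * k + 1) *
            (4 ^ (j + 2 * k) * ((j + k).factorial : ℝ) ^ 2 * ((n - j).factorial : ℝ) *
                (j.factorial : ℝ) * ((ascPochhammer ℝ k).eval (1 / 2 : ℝ)) ^ 2) /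
              (((2 * k + n + j + 1).factorial : ℝ) * ((j + 2 * k).factorial : ℝ)) *
            (1 - y ^ 2) ^ j * gegenbauer (1 / 2 + k) j 0 ^ 2 *
            gegenbauer ((j : ℝ) + k + 1) (n - j) y ^ 2 := by
  set D : ℕ → ℝ := fun p =>
    (-1) ^ p * 4 ^ (2 * k + p) * (n + 2 * k + p + 1).factorial * (k + p).factorial ^ 2 /
        ((n - p).factorial * p.factorial * (2 * k + 2 * p + 1).factorial) with hD
  set E : ℕ → ℕ → ℝ := fun j p => (-1) ^ j * (2 * (j : ℝ) + 2 * k + 1) * j.factorial ^ 2 *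
      ((ascPochhammer ℝ k).eval (1 / 2 : ℝ) * gegenbauer (1 / 2 + k) j 0) ^ 2 * p.choose j /
        ((j + 2 * k).factorial * (j + 2 * k + p + 1).factorial) with hE
  trans ∑ j ∈ Finset.range (n + 1), ∑ p ∈ Finset.range (n + 1), D p * E j p * (1 - y ^ 2) ^ p
  · rw [Finset.sum_comm,
      show 2 * y ^ 2 - 1 = 2 * (-(1 - y ^ 2)) + 1 by ring,
      show (2 * k : ℝ) = (2 * k : ℕ) by push_cast; ring, sum_jacobi_eq_sum]
    refine Finset.sum_congr rfl fun p hp => ?_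
    have hp : p ≤ n := by have := Finset.mem_range.1 hp; omega
    rw [← Finset.sum_mul, ← Finset.mul_sum, sum_gegenbauer_zero_sq k n p hp,
      askey_gasper_coeff k n p hp, neg_pow]
    ring
  refine Finset.sum_congr rfl fun j hj => Eq.symm ?_
  obtain ⟨N, rfl⟩ := Nat.exists_eq_add_of_le (Nat.lt_succ_iff.1 (Finset.mem_range.1 hj))
  rw [Nat.add_sub_cancel_left, ← Nat.cast_add, gegenbauer_sq, add_assoc j N 1,
    Finset.sum_range_add (n := j),
    Finset.sum_eq_zero (s := Finset.range j), zero_add, Finset.mul_sum]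
  · refine Finset.sum_congr rfl fun q hq => ?_
    obtain ⟨r, rfl⟩ := Nat.exists_eq_add_of_le (Nat.lt_succ_iff.1 (Finset.mem_range.1 hq))
    have h := askey_gasper_term k j q r (gegenbauer (1 / 2 + k) j 0)
    simp only [hD, hE]
    rw [← add_assoc j q r, Nat.add_sub_cancel_left, ← h, pow_add]
    ring
  · intro p hp
    simp only [hE]
    rw [Nat.choose_eq_zero_of_lt (Finset.mem_range.1 hp)]
    simp

/-- Askey–Gasper type identity for the partial sums of Jacobi polynomials, and the
resulting nonnegativity `∑_{j=0}^n P_j^{(2k,0)}(x) ≥ 0` on `[-1,1]`. -/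
theorem askey_gasper_identity (k n : ℕ) (y : ℝ) (hy : y ∈ Set.Icc (-1 : ℝ) 1) :
    (∑ j ∈ Finset.range (n + 1), jacobi (2 * k) 0 j (2 * y ^ 2 - 1)) =
        ∑ j ∈ Finset.range (n + 1),
          (2 * (j : ℝ) + 2 * k + 1) *
            (4 ^ (j + 2 * k) * ((j + k).factorial : ℝ) ^ 2 * ((n - j).factorial : ℝ) *
                (j.factorial : ℝ) * ((ascPochhammer ℝ k).eval (1 / 2 : ℝ)) ^ 2) /
              (((2 * k + n + j + 1).factorial : ℝ) * ((j + 2 * k).factorial : ℝ)) *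
            (1 - y ^ 2) ^ j * gegenbauer (1 / 2 + k) j 0 ^ 2 *
            gegenbauer ((j : ℝ) + k + 1) (n - j) y ^ 2 ∧
      ∀ x ∈ Set.Icc (-1 : ℝ) 1, 0 ≤ ∑ j ∈ Finset.range (n + 1), jacobi (2 * k) 0 j x := by
  refine ⟨askey_gasper_sum k n y, fun x hx => ?_⟩
  have hz : 0 ≤ (x + 1) / 2 := by linarith [hx.1]
  have hx' : x = 2 * √((x + 1) / 2) ^ 2 - 1 := by rw [Real.sq_sqrt hz]; ring
  have hu : 0 ≤ 1 - √((x + 1) / 2) ^ 2 := by rw [Real.sq_sqrt hz]; linarith [hx.2]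
  rw [hx', askey_gasper_sum]
  exact Finset.sum_nonneg fun j _ => by positivity
end
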